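/- The number of Kreweras walks of length 3n+2i from (0,0) to (i,0) (steps (1,1), (-1,0), (0,-1), confined to the quadrant) equals 4^n(2i+1)/((n+i+1)(2n+2i+1)) · binomial(2i, i) · binomial(3n+2i, n). -/

import Mathlib

/-- The three Kreweras steps: North-East, West, South. -/
def kStep : Fin 3 → ℤ × ℤ
  | 0 => (1, 1)
  | 1 => (-1, 0)
  | 2 => (0, -1)

/-- Position after the first `k` steps of the walk encoded by `f`. -/
def kPos {m : ℕ} (f : Fin m → Fin 3) (k : ℕ) : ℤ × ℤ :=
  ∑ i ∈ Finset.univ.filter (fun i : Fin m => (i : ℕ) < k), kStep (f i)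

/-- The walk stays in the first quadrant. -/
def KInQuadrant {m : ℕ} (f : Fin m → Fin 3) : Prop :=
  ∀ k ≤ m, 0 ≤ (kPos f k).1 ∧ 0 ≤ (kPos f k).2

open PowerSeries

section WalkRecursion

lemma kPos_snoc_of_le {m : ℕ} (g : Fin m → Fin 3) (s : Fin 3) {k : ℕ} (hk : k ≤ m) :
    kPos (Fin.snoc g s : Fin (m + 1) → Fin 3) k = kPos g k := by
  simp [kPos, Finset.sum_filter, Fin.sum_univ_castSucc, hk.not_gt]

lemma kPos_snoc_last {m : ℕ} (g : Fin m → Fin 3) (s : Fin 3) :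
    kPos (Fin.snoc g s : Fin (m + 1) → Fin 3) (m + 1) = kPos g m + kStep s := by
  simp only [kPos, Finset.sum_filter, Fin.sum_univ_castSucc, Fin.snoc_castSucc, Fin.snoc_last,
    Fin.val_castSucc, Fin.val_last, Nat.lt_succ_self, if_true]
  congr 1
  exact Finset.sum_congr rfl fun i _ => by simp [i.isLt, i.isLt.trans (Nat.lt_succ_self m)]

lemma kInQuadrant_snoc {m : ℕ} (g : Fin m → Fin 3) (s : Fin 3) :
    KInQuadrant (Fin.snoc g s : Fin (m + 1) → Fin 3) ↔
      KInQuadrant g ∧ 0 ≤ (kPos g m + kStep s).1 ∧ 0 ≤ (kPos g m + kStep s).2 := by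
  constructor
  · intro h
    refine ⟨fun k hk => ?_, ?_⟩
    · simpa only [kPos_snoc_of_le g s hk] using h k (by omega)
    · simpa only [kPos_snoc_last] using h (m + 1) le_rfl
  · rintro ⟨h, hlast⟩ k hk
    rcases Nat.le_succ_iff.mp hk with hk | rfl
    · simpa only [kPos_snoc_of_le g s hk] using h k hk
    · simpa only [kPos_snoc_last] using hlast

open Classical in
/-- The number of Kreweras walks of length `m` in the quadrant that end at `p`. -/
noncomputable def walkCount (m : ℕ) (p : ℤ × ℤ) : ℚ :=
  ∑ f : Fin m → Fin 3, if KInQuadrant f ∧ kPos f m = p then 1 else 0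

lemma natCard_eq_walkCount (m : ℕ) (p : ℤ × ℤ) :
    (Nat.card {f : Fin m → Fin 3 // KInQuadrant f ∧ kPos f m = p} : ℚ) = walkCount m p := by
  classical
  rw [walkCount, Finset.sum_boole, Nat.card_eq_fintype_card, Fintype.card_subtype]

lemma walkCount_of_not_quadrant (m : ℕ) (p : ℤ × ℤ) (hp : ¬(0 ≤ p.1 ∧ 0 ≤ p.2)) :
    walkCount m p = 0 := by
  refine Finset.sum_eq_zero fun f _ => if_neg ?_
  rintro ⟨h, rfl⟩
  exact hp (h m le_rfl)

lemma walkCount_zero (p : ℤ × ℤ) : walkCount 0 p = if p = 0 then 1 else 0 := by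
  simp [walkCount, KInQuadrant, kPos, eq_comm]

lemma walkCount_succ (m : ℕ) (p : ℤ × ℤ) (hp : 0 ≤ p.1 ∧ 0 ≤ p.2) :
    walkCount (m + 1) p = ∑ s : Fin 3, walkCount m (p - kStep s) := by
  classical
  unfold walkCount
  rw [← (Fin.snocEquiv fun _ : Fin (m + 1) => Fin 3).sum_comp, Fintype.sum_prod_type]
  refine Finset.sum_congr rfl fun s _ => Finset.sum_congr rfl fun g _ => if_congr ?_ rfl rfl
  change KInQuadrant (Fin.snoc g s : Fin (m + 1) → Fin 3) ∧
    kPos (Fin.snoc g s : Fin (m + 1) → Fin 3) (m + 1) = p ↔ _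
  rw [kInQuadrant_snoc, kPos_snoc_last, eq_sub_iff_add_eq]
  constructor
  · rintro ⟨⟨h, -⟩, h'⟩
    exact ⟨h, h'⟩
  · rintro ⟨h, rfl⟩
    exact ⟨⟨h, hp⟩, rfl⟩

lemma walkCount_succ_nat (m i j : ℕ) :
    walkCount (m + 1) (i, j) =
      walkCount m ((i : ℤ) - 1, (j : ℤ) - 1) + walkCount m ((i + 1 : ℕ), j) +
        walkCount m (i, (j + 1 : ℕ)) := by
  rw [walkCount_succ m _ (by simp), Fin.sum_univ_three]
  simp [kStep]

end WalkRecursion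

section TernarySeries

/-- The coefficient of `t ^ m` in `G ^ k`, where `G = 1 + 4 t³ G³`. -/
def ternaryCoeff : ℕ → ℕ → ℚ
  | m, 0 => if m = 0 then 1 else 0
  | m, k + 1 => ternaryCoeff m k + if 3 ≤ m then 4 * ternaryCoeff (m - 3) (k + 3) else 0
termination_by m k => (m, k)

/-- The power series `G ^ k`, where `G = 1 + 4 t³ G³`. -/
noncomputable def ternaryPow (k : ℕ) : ℚ⟦X⟧ := mk fun m => ternaryCoeff m k

lemma ternaryPow_zero : ternaryPow 0 = 1 := by
  ext m
  simp [ternaryPow, ternaryCoeff, coeff_one]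

lemma ternaryPow_succ (k : ℕ) :
    ternaryPow (k + 1) = ternaryPow k + 4 * X ^ 3 * ternaryPow (k + 3) := by
  ext m
  rw [← map_ofNat (C : ℚ →+* ℚ⟦X⟧) 4, mul_assoc, map_add, coeff_C_mul, coeff_X_pow_mul']
  simp only [ternaryPow, coeff_mk]
  rw [ternaryCoeff]
  simp

lemma eq_zero_of_ternary_rec (D : ℕ → ℚ⟦X⟧) (h0 : D 0 = 0)
    (h : ∀ k, D (k + 1) = D k + 4 * X ^ 3 * D (k + 3)) (k : ℕ) : D k = 0 := by
  suffices H : ∀ m k, coeff m (D k) = 0 by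
    ext m
    simp [H]
  intro m
  induction m using Nat.strong_induction_on with
  | _ m ihm =>
    intro k
    induction k with
    | zero => simp [h0]
    | succ k ihk =>
      rw [h, ← map_ofNat (C : ℚ →+* ℚ⟦X⟧) 4, mul_assoc, map_add, coeff_C_mul,
        coeff_X_pow_mul', ihk]
      split_ifs with hm
      · simp [ihm (m - 3) (by omega)]
      · simp

lemma ternaryPow_mul (k l : ℕ) : ternaryPow k * ternaryPow l = ternaryPow (k + l) := by
  refine sub_eq_zero.mp (eq_zero_of_ternary_rec
    (fun k => ternaryPow k * ternaryPow l - ternaryPow (k + l)) ?_ (fun k => ?_) k)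
  · simp [ternaryPow_zero]
  · rw [show k + 1 + l = k + l + 1 by ring, show k + 3 + l = k + l + 3 by ring,
      ternaryPow_succ k, ternaryPow_succ (k + l)]
    ring

lemma ternaryPow_one_pow (k : ℕ) : ternaryPow 1 ^ k = ternaryPow k := by
  induction k with
  | zero => rw [pow_zero, ternaryPow_zero]
  | succ k ih => rw [pow_succ, ih, ternaryPow_mul]

lemma ternaryPow_one_eq : ternaryPow 1 = 1 + 4 * X ^ 3 * ternaryPow 1 ^ 3 := by
  rw [ternaryPow_one_pow]
  simpa [ternaryPow_zero] using ternaryPow_succ 0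

lemma ternaryCoeff_three_mul (n k : ℕ) :
    (3 * n + k) * ternaryCoeff (3 * n) k = k * 4 ^ n * (3 * n + k).choose n := by
  induction n generalizing k with
  | zero =>
    have h : ∀ k, ternaryCoeff 0 k = 1 := fun k => by
      induction k with
      | zero => simp [ternaryCoeff]
      | succ k ih => simp [ternaryCoeff, ih]
    simp [h]
  | succ n ihn =>
    induction k with
    | zero => simp [ternaryCoeff]
    | succ k ihk =>
      have hrec : ternaryCoeff (3 * (n + 1)) (k + 1) =
          ternaryCoeff (3 * (n + 1)) k + 4 * ternaryCoeff (3 * n) (k + 3) := by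
        rw [ternaryCoeff, if_pos (by omega), show 3 * (n + 1) - 3 = 3 * n by omega]
      have h1 := ihn (k + 3)
      rw [show 3 * n + (k + 3) = 3 * n + k + 3 by ring] at h1
      rw [show 3 * (n + 1) + k = 3 * n + k + 3 by ring] at ihk
      rw [show 3 * (n + 1) + (k + 1) = 3 * n + k + 3 + 1 by ring, hrec, Nat.choose_succ_succ]
      have h2 : ((3 * n + k + 3).choose (n + 1) : ℚ) * (n + 1) =
          (3 * n + k + 3).choose n * (2 * n + k + 3) := by
        have := Nat.choose_succ_right_eq (3 * n + k + 3) n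
        rw [show 3 * n + k + 3 - n = 2 * n + k + 3 by omega] at this
        exact_mod_cast this
      have hM : (3 * n + k + 3 : ℚ) ≠ 0 := by positivity
      push_cast at h1 ihk ⊢
      have e1 : ternaryCoeff (3 * n) (k + 3) =
          (k + 3) * 4 ^ n * (3 * n + k + 3).choose n / (3 * n + k + 3) := by
        rw [eq_div_iff hM]; linear_combination h1
      have e2 : ternaryCoeff (3 * (n + 1)) k =
          k * 4 ^ (n + 1) * (3 * n + k + 3).choose (n + 1) / (3 * n + k + 3) := by
        rw [eq_div_iff hM]; linear_combination ihk
      rw [e1, e2]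
      field_simp
      linear_combination (-12 * 4 ^ n : ℚ) * h2

end TernarySeries

section CatalanSeries

/-- The power series `c` in `x` with `c = 1 + x t² G² c²`. -/
noncomputable def catalanTwist : ℚ⟦X⟧⟦X⟧ :=
  rescale (X ^ 2 * ternaryPow 1 ^ 2) (map (Nat.castRingHom ℚ⟦X⟧) catalanSeries)

lemma catalanTwist_eq :
    catalanTwist = 1 + X * C X ^ 2 * C (ternaryPow 1) ^ 2 * catalanTwist ^ 2 := by
  have h := congrArg (fun p => rescale (X ^ 2 * ternaryPow 1 ^ 2 : ℚ⟦X⟧)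
    (map (Nat.castRingHom ℚ⟦X⟧) p)) catalanSeries_sq_mul_X_add_one
  simp only [map_add, map_mul, map_pow, map_one, map_X, rescale_X] at h
  change catalanTwist ^ 2 * _ + 1 = catalanTwist at h
  linear_combination -h

lemma coeff_catalanTwist (i : ℕ) :
    coeff i catalanTwist = (X ^ 2 * ternaryPow 1 ^ 2) ^ i * (catalan i : ℚ⟦X⟧) := by
  simp [catalanTwist, coeff_rescale]

lemma coeff_catalanTwist_sq (i : ℕ) :
    coeff i (catalanTwist ^ 2) = (X ^ 2 * ternaryPow 1 ^ 2) ^ i * (catalan (i + 1) : ℚ⟦X⟧) := by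
  have h := congrArg (coeff (i + 1)) catalanSeries_sq_mul_X_add_one
  rw [map_add, coeff_succ_mul_X] at h
  simp [coeff_one] at h
  rw [catalanTwist, ← map_pow, ← map_pow, coeff_rescale, coeff_map, h]
  simp

end CatalanSeries

section KernelEquation

/-- The generating function of Kreweras walks ending on the `x`-axis. -/
noncomputable def axisSeries : ℚ⟦X⟧⟦X⟧ :=
  C (ternaryPow 1) * catalanTwist *
    (1 - 2 * C X ^ 3 * C (ternaryPow 1) ^ 3 * catalanTwist)

lemma kernel_identity {R : Type*} [CommRing R] (t x y G c d : R)
    (hG : G = 1 + 4 * t ^ 3 * G ^ 3) (hc : c = 1 + x * t ^ 2 * G ^ 2 * c ^ 2)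
    (hd : d = 1 + y * t ^ 2 * G ^ 2 * d ^ 2) :
    (x * y - x * t * (G * c * (1 - 2 * t ^ 3 * G ^ 3 * c))
        - y * t * (G * d * (1 - 2 * t ^ 3 * G ^ 3 * d))) *
      (1 - x * t ^ 2 * G ^ 2 * c - y * t ^ 2 * G ^ 2 * d
        + 2 * (x * t ^ 2 * G ^ 2 * c) * (y * t ^ 2 * G ^ 2 * d) - x * y * t * G) =
    (x * y - t * (x + y + x ^ 2 * y ^ 2)) * (G * (1 - 2 * t ^ 3 * G ^ 3 * c * d)) := by
  grind

lemma exists_kernel_solution : ∃ Q : ℚ⟦X⟧⟦X⟧⟦X⟧,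
    C X * X * Q = C (C X) * (C X + X + C X ^ 2 * X ^ 2) * Q + C X * X
      - C (X * C X * axisSeries) - X * C (C X) * map C axisSeries := by
  have hG : C (C (ternaryPow 1)) =
      (1 : ℚ⟦X⟧⟦X⟧⟦X⟧) + 4 * C (C X) ^ 3 * C (C (ternaryPow 1)) ^ 3 := by
    have := congrArg (fun p : ℚ⟦X⟧ => (C (C p) : ℚ⟦X⟧⟦X⟧⟦X⟧)) ternaryPow_one_eq
    simpa only [map_add, map_mul, map_pow, map_one, map_ofNat] using this
  have hc : C catalanTwist = 1 + C X * C (C X) ^ 2 * C (C (ternaryPow 1)) ^ 2 *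
      (C catalanTwist : ℚ⟦X⟧⟦X⟧⟦X⟧) ^ 2 := by
    have := congrArg (fun p : ℚ⟦X⟧⟦X⟧ => (C p : ℚ⟦X⟧⟦X⟧⟦X⟧)) catalanTwist_eq
    simpa only [map_add, map_mul, map_pow, map_one] using this
  have hd : map C catalanTwist = 1 + X * C (C X) ^ 2 * C (C (ternaryPow 1)) ^ 2 *
      (map C catalanTwist : ℚ⟦X⟧⟦X⟧⟦X⟧) ^ 2 := by
    have := congrArg (fun p : ℚ⟦X⟧⟦X⟧ => (map C p : ℚ⟦X⟧⟦X⟧⟦X⟧)) catalanTwist_eq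
    simpa only [map_add, map_mul, map_pow, map_one, map_X, map_C] using this
  have key := kernel_identity (C (C X)) (C X) X _ _ _ hG hc hd
  set D : ℚ⟦X⟧⟦X⟧⟦X⟧ := 1 - C X * C (C X) ^ 2 * C (C (ternaryPow 1)) ^ 2 * C catalanTwist
    - X * C (C X) ^ 2 * C (C (ternaryPow 1)) ^ 2 * map C catalanTwist
    + 2 * (C X * C (C X) ^ 2 * C (C (ternaryPow 1)) ^ 2 * C catalanTwist) *
      (X * C (C X) ^ 2 * C (C (ternaryPow 1)) ^ 2 * map C catalanTwist)
    - C X * X * C (C X) * C (C (ternaryPow 1)) with hD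
  have hunit : IsUnit D := by
    rw [isUnit_iff_constantCoeff, isUnit_iff_constantCoeff]
    simp [hD]
  obtain ⟨E, hE⟩ := hunit.exists_right_inv
  refine ⟨C (C (ternaryPow 1)) * (1 - 2 * C (C X) ^ 3 * C (C (ternaryPow 1)) ^ 3 *
    C catalanTwist * map C catalanTwist) * E, ?_⟩
  simp only [axisSeries, map_mul, map_sub, map_pow, map_one, map_ofNat, map_C]
  linear_combination (-E) * key + (C X * X
    - C X * C (C X) * (C (C (ternaryPow 1)) * C catalanTwist *
      (1 - 2 * C (C X) ^ 3 * C (C (ternaryPow 1)) ^ 3 * C catalanTwist))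
    - X * C (C X) * (C (C (ternaryPow 1)) * map C catalanTwist *
      (1 - 2 * C (C X) ^ 3 * C (C (ternaryPow 1)) ^ 3 * map C catalanTwist))) * hE

lemma coeff_kernel_solution (Q : ℚ⟦X⟧⟦X⟧⟦X⟧)
    (hQ : C X * X * Q = C (C X) * (C X + X + C X ^ 2 * X ^ 2) * Q + C X * X
      - C (X * C X * axisSeries) - X * C (C X) * map C axisSeries) (m i j : ℕ) :
    walkCount m (i, j) = coeff m (coeff i (coeff j Q)) := by
  have hcoeff (i j : ℕ) : coeff i (coeff j Q) =
      X * (coeff (i + 1) (coeff j Q) + coeff i (coeff (j + 1) Q) +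
        if 1 ≤ i ∧ 1 ≤ j then coeff (i - 1) (coeff (j - 1) Q) else 0) +
      if i = 0 ∧ j = 0 then 1 else 0 := by
    have hQ' : X * (C X * Q) = C (C X) * (C X * Q + X * Q + C X ^ 2 * (X ^ 2 * Q)) + X * C X
      - C (X * C X * axisSeries) - X * (C (C X) * map C axisSeries) := by
      linear_combination hQ
    have h := congrArg (fun p => coeff (i + 1) (coeff (j + 1) p)) hQ'
    simp only [map_sub, map_add, coeff_succ_X_mul, coeff_C_mul, ← map_pow, coeff_X_pow_mul',
      coeff_C_mul, coeff_map, coeff_C, Nat.succ_ne_zero, if_false, map_zero, apply_ite,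
      coeff_X_pow_mul', mul_zero, sub_zero] at h
    rcases i with _ | i <;> rcases j with _ | j <;> simp [coeff_X] at h ⊢ <;>
      linear_combination h
  induction m generalizing i j with
  | zero =>
    rw [walkCount_zero, hcoeff, map_add, coeff_zero_X_mul]
    by_cases hij : i = 0 ∧ j = 0 <;> simp [hij]
  | succ m ih =>
    rw [walkCount_succ_nat, hcoeff, map_add, coeff_succ_X_mul, ih, ih, map_add, map_add]
    have hlast : coeff (m + 1) (if i = 0 ∧ j = 0 then 1 else 0 : ℚ⟦X⟧) = 0 := by
      split_ifs <;> simp [coeff_one]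
    have hdiag : walkCount m ((i : ℤ) - 1, (j : ℤ) - 1) =
        coeff m (if 1 ≤ i ∧ 1 ≤ j then coeff (i - 1) (coeff (j - 1) Q) else 0) := by
      split_ifs with hij
      · rw [← ih, Nat.cast_sub hij.1, Nat.cast_sub hij.2, Nat.cast_one]
      · rw [walkCount_of_not_quadrant _ _ (by simp only; omega), map_zero]
    rw [hlast, hdiag]
    ring

lemma coeff_zero_kernel_solution (Q : ℚ⟦X⟧⟦X⟧⟦X⟧)
    (hQ : C X * X * Q = C (C X) * (C X + X + C X ^ 2 * X ^ 2) * Q + C X * X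
      - C (X * C X * axisSeries) - X * C (C X) * map C axisSeries) :
    coeff 0 Q = axisSeries := by
  have h := congrArg constantCoeff hQ
  simp only [map_sub, map_add, map_mul, constantCoeff_X, constantCoeff_C, mul_zero, zero_mul,
    map_pow, add_zero, sub_zero, ne_eq, OfNat.ofNat_ne_zero, not_false_eq_true,
    zero_pow] at h
  have hX : (C X * X : ℚ⟦X⟧⟦X⟧) ≠ 0 :=
    mul_ne_zero ((map_ne_zero_iff C C_injective).mpr X_ne_zero) X_ne_zero
  rw [coeff_zero_eq_constantCoeff]
  exact mul_left_cancel₀ hX (by linear_combination -h)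

lemma coeff_axisSeries (n i : ℕ) : coeff (3 * n + 2 * i) (coeff i axisSeries) =
    4 ^ n * (2 * i + 1) / ((n + i + 1) * (2 * n + 2 * i + 1)) *
        Nat.choose (2 * i) i * Nat.choose (3 * n + 2 * i) n := by
  have h : coeff i axisSeries = X ^ (2 * i) * (C (catalan i : ℚ) * ternaryPow (2 * i + 1)
      - X ^ 3 * (C (2 * catalan (i + 1) : ℚ) * ternaryPow (2 * i + 4))) := by
    rw [axisSeries, show C (ternaryPow 1) * catalanTwist *
      (1 - 2 * C X ^ 3 * C (ternaryPow 1) ^ 3 * catalanTwist) =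
      C (ternaryPow 1) * catalanTwist -
        C (2 * X ^ 3 * ternaryPow 1 ^ 4) * catalanTwist ^ 2 by
        simp only [map_mul, map_pow, map_ofNat]; ring,
      map_sub, coeff_C_mul, coeff_C_mul, coeff_catalanTwist, coeff_catalanTwist_sq,
      ← ternaryPow_one_pow (2 * i + 1), ← ternaryPow_one_pow (2 * i + 4)]
    simp only [map_mul, map_natCast, map_ofNat]
    ring
  have hcat : ((i : ℚ) + 1) * catalan i = (2 * i).choose i := by
    exact_mod_cast succ_mul_catalan_eq_centralBinom i
  have hcat' : ((i : ℚ) + 2) * catalan (i + 1) = 2 * (2 * i + 1) * catalan i := by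
    have h1 := succ_mul_catalan_eq_centralBinom (i + 1)
    have h2 := Nat.succ_mul_centralBinom_succ i
    rw [← h1, ← succ_mul_catalan_eq_centralBinom i] at h2
    have h3 : ((i : ℚ) + 1) * ((i + 1 + 1) * catalan (i + 1)) =
      2 * (2 * i + 1) * ((i + 1) * catalan i) := by exact_mod_cast h2
    have hi : (i : ℚ) + 1 ≠ 0 := by positivity
    exact mul_left_cancel₀ hi (by linear_combination h3)
  rw [h, coeff_X_pow_mul, map_sub, coeff_C_mul, coeff_X_pow_mul', ← hcat]
  simp only [ternaryPow, coeff_mk]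
  cases n with
  | zero =>
    have h0 := ternaryCoeff_three_mul 0 (2 * i + 1)
    have hi : (2 * i + 1 : ℚ) ≠ 0 := by positivity
    have h1 : ternaryCoeff 0 (2 * i + 1) = 1 := mul_left_cancel₀ hi (by simpa using h0)
    simp [h1]
    field_simp
  | succ n =>
    have ha := ternaryCoeff_three_mul (n + 1) (2 * i + 1)
    have hb := ternaryCoeff_three_mul n (2 * i + 4)
    have e1 := Nat.add_one_mul_choose_eq (3 * n + 2 * i + 3) n
    have e2 := Nat.choose_mul_succ_eq (3 * n + 2 * i + 3) n
    have e3 := Nat.choose_succ_right_eq (3 * n + 2 * i + 3) n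
    rw [show 3 * n + 2 * i + 3 + 1 - n = 2 * n + 2 * i + 4 by omega] at e2
    rw [show 3 * n + 2 * i + 3 - n = 2 * n + 2 * i + 3 by omega] at e3
    rw [if_pos (by omega), show 3 * (n + 1) - 3 = 3 * n by omega, coeff_C_mul, coeff_mk,
      show 3 * (n + 1) + 2 * i = 3 * n + 2 * i + 3 by ring]
    rw [show 3 * (n + 1) + (2 * i + 1) = 3 * n + 2 * i + 3 + 1 by ring] at ha
    rw [show 3 * n + (2 * i + 4) = 3 * n + 2 * i + 3 + 1 by ring] at hb
    qify at e1 e2 e3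
    push_cast at ha hb ⊢
    have hM : (3 * n + 2 * i + 4 : ℚ) ≠ 0 := by positivity
    set B : ℚ := Nat.cast (Nat.choose (3 * n + 2 * i + 3) n)
    have f1 : ((3 * n + 2 * i + 3 + 1).choose (n + 1) : ℚ) =
        (3 * n + 2 * i + 4) * B / (n + 1) := by
      rw [eq_div_iff (by positivity)]; linear_combination -e1
    have f2 : ((3 * n + 2 * i + 3 + 1).choose n : ℚ) =
        (3 * n + 2 * i + 4) * B / (2 * n + 2 * i + 4) := by
      rw [eq_div_iff (by positivity)]; linear_combination -e2
    have f3 : ((3 * n + 2 * i + 3).choose (n + 1) : ℚ) =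
        (2 * n + 2 * i + 3) * B / (n + 1) := by
      rw [eq_div_iff (by positivity)]; linear_combination e3
    have ga : ternaryCoeff (3 * (n + 1)) (2 * i + 1) = (2 * i + 1) * 4 ^ (n + 1) * B / (n + 1) := by
      refine mul_left_cancel₀ hM ?_
      rw [f1] at ha
      linear_combination ha
    have gb : ternaryCoeff (3 * n) (2 * i + 4) =
        (2 * i + 4) * 4 ^ n * B / (2 * n + 2 * i + 4) := by
      refine mul_left_cancel₀ hM ?_
      rw [f2] at hb
      linear_combination hb
    have gc : (catalan (i + 1) : ℚ) = 2 * (2 * i + 1) * catalan i / (i + 2) := by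
      rw [eq_div_iff (by positivity)]; linear_combination hcat'
    rw [ga, gb, gc, f3]
    field_simp
    ring

end KernelEquation

theorem kreweras_count_x_axis (n i : ℕ) :
    (Nat.card {f : Fin (3 * n + 2 * i) → Fin 3 //
        KInQuadrant f ∧ kPos f (3 * n + 2 * i) = ((i : ℤ), 0)} : ℚ) =
      4 ^ n * (2 * i + 1) / ((n + i + 1) * (2 * n + 2 * i + 1)) *
        Nat.choose (2 * i) i * Nat.choose (3 * n + 2 * i) n := by
  obtain ⟨Q, hQ⟩ := exists_kernel_solution
  rw [natCard_eq_walkCount, ← Nat.cast_zero, coeff_kernel_solution Q hQ,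
    coeff_zero_kernel_solution Q hQ, coeff_axisSeries]
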